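/- Let C and D be coalgebras over a field k, let ι: D → C be a coalgebra homomorphism, and let P: C → D be a k-linear map with P∘ι = id_D and Δ_D∘P = (P ⊗ P)∘Δ_C. Then the following are equivalent: (a) ι(P(c)) = c₍₁₎ε_D(P(c₍₂₎)) = ε_D(P(c₍₁₎))c₍₂₎ for all c ∈ C; (b) Δ_C(ι(P(c))) = c₍₁₎ ⊗ ι(P(c₍₂₎)) = ι(P(c₍₁₎)) ⊗ c₍₂₎ = ι(P(c₍₁₎)) ⊗ ι(P(c₍₂₎)) for all c ∈ C. -/

import Mathlib

open TensorProduct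

section SliceMaps

variable {R A : Type*} [CommSemiring R] [AddCommMonoid A] [Module R A] [Coalgebra R A]

/-- The right slice map `a ↦ a₍₁₎ f(a₍₂₎)` is left colinear. -/
theorem comul_rid_map_id_comul (f : A →ₗ[R] R) (a : A) :
    Coalgebra.comul (R := R) (TensorProduct.rid R A (TensorProduct.map LinearMap.id f (Coalgebra.comul a))) =
      TensorProduct.map LinearMap.id
        ((TensorProduct.rid R A).toLinearMap ∘ₗ TensorProduct.map LinearMap.id f ∘ₗ Coalgebra.comul)
        (Coalgebra.comul (R := R) a) := by
  have slice (x : A ⊗[R] A) :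
      Coalgebra.comul (R := R) (TensorProduct.rid R A (TensorProduct.map LinearMap.id f x)) =
        ((TensorProduct.rid R A).toLinearMap ∘ₗ TensorProduct.map LinearMap.id f).lTensor A
          (TensorProduct.assoc R A A A (Coalgebra.comul.rTensor A x)) := by
    induction x with
    | zero => simp
    | add x y hx hy => simp only [map_add, hx, hy]
    | tmul x y =>
      simp only [TensorProduct.map_tmul, LinearMap.id_apply, TensorProduct.rid_tmul, map_smul,
        LinearMap.rTensor_tmul]
      induction Coalgebra.comul (R := R) x with
      | zero => simp
      | add u v hu hv => simp only [smul_add, TensorProduct.add_tmul, map_add, hu, hv]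
      | tmul u v => simp
  rw [slice, Coalgebra.coassoc_apply, ← LinearMap.comp_apply, ← LinearMap.lTensor_comp]
  rfl

/-- The left slice map `a ↦ f(a₍₁₎) a₍₂₎` is right colinear. -/
theorem comul_lid_map_id_comul (f : A →ₗ[R] R) (a : A) :
    Coalgebra.comul (R := R) (TensorProduct.lid R A (TensorProduct.map f LinearMap.id (Coalgebra.comul a))) =
      TensorProduct.map
        ((TensorProduct.lid R A).toLinearMap ∘ₗ TensorProduct.map f LinearMap.id ∘ₗ Coalgebra.comul)
        LinearMap.id (Coalgebra.comul (R := R) a) := by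
  have slice (x : A ⊗[R] A) :
      Coalgebra.comul (R := R) (TensorProduct.lid R A (TensorProduct.map f LinearMap.id x)) =
        ((TensorProduct.lid R A).toLinearMap ∘ₗ TensorProduct.map f LinearMap.id).rTensor A
          ((TensorProduct.assoc R A A A).symm (Coalgebra.comul.lTensor A x)) := by
    induction x with
    | zero => simp
    | add x y hx hy => simp only [map_add, hx, hy]
    | tmul x y =>
      simp only [TensorProduct.map_tmul, LinearMap.id_apply, TensorProduct.lid_tmul, map_smul,
        LinearMap.lTensor_tmul]
      induction Coalgebra.comul (R := R) y with
      | zero => simp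
      | add u v hu hv => simp only [smul_add, TensorProduct.tmul_add, map_add, hu, hv]
      | tmul u v => simp [TensorProduct.smul_tmul']
  rw [slice, Coalgebra.coassoc_symm_apply, ← LinearMap.comp_apply, ← LinearMap.rTensor_comp]
  rfl

end SliceMaps

/-- Let `ι : D → C` be a coalgebra homomorphism and `P : C → D` a linear map with
`P ∘ ι = id` and `Δ_D ∘ P = (P ⊗ P) ∘ Δ_C`. Then
(a) `ι(P(c)) = ∑ c₍₁₎ε_D(P(c₍₂₎)) = ∑ ε_D(P(c₍₁₎))c₍₂₎` for all `c`, if and only if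
(b) `Δ_C(ι(P(c))) = ∑ c₍₁₎ ⊗ ι(P(c₍₂₎)) = ∑ ι(P(c₍₁₎)) ⊗ c₍₂₎ = ∑ ι(P(c₍₁₎)) ⊗ ι(P(c₍₂₎))`
for all `c`. -/
theorem coalgebra_projection_conditions_equiv
    {k C D : Type*} [Field k]
    [AddCommGroup C] [Module k C] [Coalgebra k C]
    [AddCommGroup D] [Module k D] [Coalgebra k D]
    (ι : D →ₗc[k] C) (P : C →ₗ[k] D)
    (hPι : ∀ d : D, P (ι d) = d)
    (hPcomul : ∀ c : C,
      Coalgebra.comul (R := k) (P c) = TensorProduct.map P P (Coalgebra.comul (R := k) c)) :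
    (∀ c : C,
      ι (P c) = (TensorProduct.rid k C)
          (TensorProduct.map LinearMap.id (Coalgebra.counit ∘ₗ P) (Coalgebra.comul (R := k) c)) ∧
      ι (P c) = (TensorProduct.lid k C)
          (TensorProduct.map (Coalgebra.counit ∘ₗ P) LinearMap.id (Coalgebra.comul (R := k) c)))
    ↔
    (∀ c : C,
      Coalgebra.comul (R := k) (ι (P c)) =
        TensorProduct.map LinearMap.id (ι.toLinearMap ∘ₗ P) (Coalgebra.comul (R := k) c) ∧
      Coalgebra.comul (R := k) (ι (P c)) =
        TensorProduct.map (ι.toLinearMap ∘ₗ P) LinearMap.id (Coalgebra.comul (R := k) c) ∧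
      Coalgebra.comul (R := k) (ι (P c)) =
        TensorProduct.map (ι.toLinearMap ∘ₗ P) (ι.toLinearMap ∘ₗ P) (Coalgebra.comul (R := k) c)) := by
  have counit_ι : Coalgebra.counit (R := k) ∘ₗ ι.toLinearMap ∘ₗ P = Coalgebra.counit ∘ₗ P := by
    ext c
    exact CoalgHomClass.counit_comp_apply ι (P c)
  constructor
  · intro h c
    have right_slice : ι.toLinearMap ∘ₗ P = (TensorProduct.rid k C).toLinearMap ∘ₗ
        TensorProduct.map LinearMap.id (Coalgebra.counit ∘ₗ P) ∘ₗ Coalgebra.comul :=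
      LinearMap.ext fun c => (h c).1
    have left_slice : ι.toLinearMap ∘ₗ P = (TensorProduct.lid k C).toLinearMap ∘ₗ
        TensorProduct.map (Coalgebra.counit ∘ₗ P) LinearMap.id ∘ₗ Coalgebra.comul :=
      LinearMap.ext fun c => (h c).2
    refine ⟨?_, ?_, ?_⟩
    · rw [right_slice, ← comul_rid_map_id_comul, ← (h c).1]
    · rw [left_slice, ← comul_lid_map_id_comul, ← (h c).2]
    · rw [TensorProduct.map_comp, LinearMap.comp_apply, ← hPcomul]
      exact (CoalgHomClass.map_comp_comul_apply ι (P c)).symm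
  · intro h c
    constructor
    · have key := congrArg (fun x => TensorProduct.rid k C (Coalgebra.counit.lTensor C x)) (h c).1
      simpa only [Coalgebra.lTensor_counit_comul, TensorProduct.rid_tmul, one_smul,
        LinearMap.lTensor_map, counit_ι] using key
    · have key := congrArg (fun x => TensorProduct.lid k C (Coalgebra.counit.rTensor C x)) (h c).2.1
      simpa only [Coalgebra.rTensor_counit_comul, TensorProduct.lid_tmul, one_smul,
        LinearMap.rTensor_map, counit_ι] using key
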